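/- arXiv:1706.02379 — 3 statements merged into one kernel-verified Lean document; each statement's English description precedes it below -/
import Mathlib

section
/- Let Δ > 0 and let Q_s be the stochastic rounding operator with resolution Δ. If w ∈ Δℤ is a point on the quantization grid and v ∈ ℝ is any perturbation, then the expected squared rounding error of the perturbed point satisfies 𝔼[(Q_s(w + v) − (w + v))²] ≤ Δ·|v|. -/
open MeasureTheory

/-- The integral over the unit interval of a step function with a single jump at `q`. -/
theorem integral_unitInterval_ite_le {q : ℝ} (h0 : 0 ≤ q) (h1 : q ≤ 1) (a b : ℝ) :
    ∫ p in (0 : ℝ)..1, (if p ≤ q then a else b) = q * a + (1 - q) * b := by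
  have left : Set.EqOn (fun _ : ℝ => a) (fun p => if p ≤ q then a else b) (Set.uIoc 0 q) := by
    intro p hp
    rw [Set.uIoc_of_le h0] at hp
    exact (if_pos hp.2).symm
  have right : Set.EqOn (fun _ : ℝ => b) (fun p => if p ≤ q then a else b) (Set.uIoc q 1) := by
    intro p hp
    rw [Set.uIoc_of_le h1] at hp
    exact (if_neg hp.1.not_ge).symm
  rw [← intervalIntegral.integral_add_adjacent_intervals
      (intervalIntegrable_const.congr left) (intervalIntegrable_const.congr right),
    ← intervalIntegral.integral_congr_ae (.of_forall left),
    ← intervalIntegral.integral_congr_ae (.of_forall right)]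
  simp

/-- The Bernoulli variance of the fractional part of `x` is at most `|x|`. -/
theorem fract_mul_one_sub_fract_le_abs (x : ℝ) : Int.fract x * (1 - Int.fract x) ≤ |x| := by
  have h0 := Int.fract_nonneg x
  have h1 := Int.fract_lt_one x
  have hx := Int.floor_add_fract x
  rcases le_or_gt 0 x with h | h
  · have hf : (0 : ℝ) ≤ ⌊x⌋ := mod_cast Int.floor_nonneg.2 h
    rw [abs_of_nonneg h]
    nlinarith
  · have hn : ⌊x⌋ < 0 := Int.floor_lt.2 (by simpa using h)
    have hf : (⌊x⌋ : ℝ) ≤ -1 := mod_cast (by lia : ⌊x⌋ ≤ -1)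
    rw [abs_of_neg h]
    nlinarith

/-- **Rounding error of a perturbed grid point.**
For quantization step `Δ > 0`, if `w ∈ Δℤ` is on the quantization grid and `v ∈ ℝ` is any
perturbation, then the stochastic rounding operator `Q_s` (driven by a uniform random
variable on `[0,1]`) satisfies `𝔼[(Q_s(w + v) − (w + v))²] ≤ Δ·|v|`. -/
theorem stochastic_rounding_perturbed_grid_point
    (Δ : ℝ) (hΔ : 0 < Δ)
    (w : ℝ) (hw : ∃ m : ℤ, w = Δ * m) (v : ℝ)
    (Qs : ℝ → ℝ → ℝ)
    (hQs : ∀ u p : ℝ, Qs u p =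
      if p ≤ u / Δ - ⌊u / Δ⌋ then Δ * (⌊u / Δ⌋ + 1) else Δ * ⌊u / Δ⌋) :
    (∫ p in (0:ℝ)..1, (Qs (w + v) p - (w + v)) ^ 2) ≤ Δ * |v| := by
  obtain ⟨m, rfl⟩ := hw
  have hu : (Δ * m + v) / Δ = v / Δ + m := by field_simp; ring
  have hv : v = Δ * (⌊v / Δ⌋ + Int.fract (v / Δ)) := by
    rw [Int.floor_add_fract]; field_simp
  have hsq : ∀ p : ℝ, (Qs (Δ * m + v) p - (Δ * m + v)) ^ 2 =
      if p ≤ Int.fract (v / Δ) then (Δ * (1 - Int.fract (v / Δ))) ^ 2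
      else (Δ * Int.fract (v / Δ)) ^ 2 := by
    intro p
    rw [hQs, hu, Int.self_sub_floor, Int.fract_add_intCast, Int.floor_add_intCast]
    push_cast
    split_ifs
    · congr 1
      linear_combination -hv
    · rw [← neg_sq]
      congr 1
      linear_combination hv
  simp_rw [hsq]
  rw [integral_unitInterval_ite_le (Int.fract_nonneg _) (Int.fract_lt_one _).le]
  calc _ = Δ ^ 2 * (Int.fract (v / Δ) * (1 - Int.fract (v / Δ))) := by ring
    _ ≤ Δ ^ 2 * |v / Δ| := by gcongr; exact fract_mul_one_sub_fract_le_abs _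
    _ = Δ * |v| := by rw [abs_div, abs_of_pos hΔ]; field_simp
end

section
/- (Finite-state form of Theorem 5: the stationary distribution of stochastic rounding is asymptotically invariant to the learning rate) Let n ≥ 1, let Ũ be an n×n nonnegative matrix with zero diagonal, let α₀ > 0 be the largest constant such that T̃_{α₀} := I − α₀·diag(𝟙ᵀŨ) + α₀·Ũ has nonnegative entries, and suppose T̃_{α₀} is column-stochastic with a stationary distribution π̃ that is the unique eigenvector (up to scaling) for the simple eigenvalue 1. Let (T_α)_{α>0} be a family of column-stochastic n×n matrices such that |T_α(x,y) − T̃_α(x,y)| ≤ C·α² for all entries (x,y) and all small α > 0, where T̃_α := I − α·diag(𝟙ᵀŨ) + α·Ũ and C is a constant. Then for all sufficiently small α, T_α has a stationary distribution π_α, and lim_{α→0} π_α = π̃. Moreover, if every state of the chain T̃_{α₀} is accessible from every other state (all one-step neighbor transition probabilities are positive), then π̃(x) > 0 for every state x, so the limiting distribution is not concentrated on any strict subset of states. -/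
open Filter

/-- A column-stochastic matrix has a stationary distribution. -/
theorem Matrix.exists_stationary_of_colStochastic {ι : Type*} [Fintype ι] [DecidableEq ι]
    [Nonempty ι] (A : Matrix ι ι ℝ) (hA : ∀ i j, 0 ≤ A i j) (hcol : ∀ j, ∑ i, A i j = 1) :
    ∃ v : ι → ℝ, (∀ i, 0 ≤ v i) ∧ ∑ i, v i = 1 ∧ A.mulVec v = v := by
  have hleft : ∃ w : ι → ℝ, w ≠ 0 ∧ Matrix.vecMul w (1 - A) = 0 := by
    refine ⟨fun _ => 1, fun h => ?_, ?_⟩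
    · simpa using congrFun h (Classical.arbitrary ι)
    · ext j
      rw [Matrix.vecMul_sub, Matrix.vecMul_one]
      simp [Matrix.vecMul, dotProduct, hcol]
  obtain ⟨u, hu0, hu⟩ :=
    Matrix.exists_mulVec_eq_zero_iff.2 (Matrix.exists_vecMul_eq_zero_iff.1 hleft)
  have hfix : A.mulVec u = u := by
    rw [Matrix.sub_mulVec, Matrix.one_mulVec, sub_eq_zero] at hu
    exact hu.symm
  have hle : ∀ i, |u i| ≤ A.mulVec (fun j => |u j|) i := fun i => by
    calc |u i| = |∑ j, A i j * u j| := congrArg _ (congrFun hfix i).symm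
      _ ≤ ∑ j, |A i j * u j| := Finset.abs_sum_le_sum_abs _ _
      _ = ∑ j, A i j * |u j| :=
        Finset.sum_congr rfl fun j _ => by rw [abs_mul, abs_of_nonneg (hA i j)]
  have hsum : ∑ i, |u i| = ∑ i, A.mulVec (fun j => |u j|) i := by
    simp only [Matrix.mulVec, dotProduct]
    rw [Finset.sum_comm]
    simp [← Finset.sum_mul, hcol]
  have heq := (Finset.sum_eq_sum_iff_of_le fun i _ => hle i).1 hsum
  have hpos : 0 < ∑ i, |u i| := by
    obtain ⟨i, hi⟩ := Function.ne_iff.1 hu0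
    exact Finset.sum_pos' (fun i _ => abs_nonneg _) ⟨i, Finset.mem_univ i, abs_pos.2 hi⟩
  refine ⟨(∑ i, |u i|)⁻¹ • fun j => |u j|, fun i => ?_, ?_, ?_⟩
  · exact mul_nonneg (inv_nonneg.2 hpos.le) (abs_nonneg _)
  · simp only [Pi.smul_apply, smul_eq_mul]
    rw [← Finset.mul_sum, inv_mul_cancel₀ hpos.ne']
  · rw [Matrix.mulVec_smul]
    congr 1
    exact funext fun i => (heq i (Finset.mem_univ i)).symm

/-- Every column-stochastic perturbation of order `α ^ 2` of `1 + α • Q` has stationary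
distributions converging, as `α` decreases to `0`, to the only probability vector in the kernel
of `Q`. -/
theorem Matrix.tendsto_stationary_of_approx {ι : Type*} [Fintype ι] [DecidableEq ι]
    (Q : Matrix ι ι ℝ) (p : ι → ℝ)
    (hp : ∀ q : ι → ℝ, ∑ i, q i = 1 → Q.mulVec q = 0 → q = p)
    (T : ℝ → Matrix ι ι ℝ) (C : ℝ)
    (happrox : ∀ᶠ α in nhdsWithin (0 : ℝ) (Set.Ioi 0),
      ∀ i j, |T α i j - (1 + α • Q) i j| ≤ C * α ^ 2)
    (π : ℝ → ι → ℝ)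
    (hπ : ∀ α : ℝ, 0 < α →
      (∀ i, 0 ≤ π α i) ∧ ∑ i, π α i = 1 ∧ (T α).mulVec (π α) = π α) :
    Tendsto π (nhdsWithin (0 : ℝ) (Set.Ioi 0)) (nhds p) := by
  have hev : ∀ᶠ α in nhdsWithin (0 : ℝ) (Set.Ioi 0), (0 : ℝ) < α := self_mem_nhdsWithin
  have hbound : ∀ᶠ α in nhdsWithin (0 : ℝ) (Set.Ioi 0),
      ∀ i, |Q.mulVec (π α) i| ≤ C * α := by
    filter_upwards [happrox, hev] with α hα hpos i
    obtain ⟨hnn, hsum, hfix⟩ := hπ α hpos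
    have hdiff : α * Q.mulVec (π α) i = -∑ j, (T α i j - (1 + α • Q) i j) * π α j := by
      have h : (T α - (1 + α • Q)).mulVec (π α) = -(α • Q.mulVec (π α)) := by
        rw [Matrix.sub_mulVec, hfix, Matrix.add_mulVec, Matrix.one_mulVec, Matrix.smul_mulVec]
        abel
      have hi := congrFun h i
      simp only [Matrix.mulVec, dotProduct, Matrix.sub_apply, Pi.neg_apply, Pi.smul_apply,
        smul_eq_mul] at hi ⊢
      rw [hi, neg_neg]
    have hle : α * |Q.mulVec (π α) i| ≤ α * (C * α) := by
      calc α * |Q.mulVec (π α) i| = |α * Q.mulVec (π α) i| := by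
            rw [abs_mul, abs_of_pos hpos]
        _ = |∑ j, (T α i j - (1 + α • Q) i j) * π α j| := by rw [hdiff, abs_neg]
        _ ≤ ∑ j, |(T α i j - (1 + α • Q) i j) * π α j| := Finset.abs_sum_le_sum_abs _ _
        _ ≤ ∑ j, C * α ^ 2 * π α j := Finset.sum_le_sum fun j _ => by
            rw [abs_mul, abs_of_nonneg (hnn j)]
            exact mul_le_mul_of_nonneg_right (hα i j) (hnn j)
        _ = α * (C * α) := by rw [← Finset.mul_sum, hsum]; ring
    exact le_of_mul_le_mul_left hle hpos
  have hCα : Tendsto (fun α : ℝ => C * α) (nhdsWithin (0 : ℝ) (Set.Ioi 0)) (nhds 0) := by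
    have h : Tendsto (fun α : ℝ => C * α) (nhds 0) (nhds (C * 0)) :=
      (continuous_const.mul continuous_id).tendsto 0
    rw [mul_zero] at h
    exact h.mono_left nhdsWithin_le_nhds
  have hQ : Tendsto (fun α => Q.mulVec (π α)) (nhdsWithin (0 : ℝ) (Set.Ioi 0)) (nhds 0) :=
    tendsto_pi_nhds.2 fun i => squeeze_zero_norm' (hbound.mono fun α h => h i) hCα
  refine (isCompact_stdSimplex ℝ ι).tendsto_nhds_of_unique_mapClusterPt
    (hev.mono fun α hα => ⟨(hπ α hα).1, (hπ α hα).2.1⟩) fun q hq hcl => hp q hq.2 ?_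
  have hcont : Continuous fun v : ι → ℝ => Q.mulVec v := continuous_const.matrix_mulVec continuous_id
  have hcl' : MapClusterPt (Q.mulVec q) (nhdsWithin (0 : ℝ) (Set.Ioi 0))
      ((fun v => Q.mulVec v) ∘ π) := hcl.continuousAt_comp hcont.continuousAt
  have : (nhds (Q.mulVec q) ⊓ nhds 0).NeBot := hcl'.neBot.mono (inf_le_inf_left _ hQ)
  exact eq_of_nhds_neBot this

/-- A stationary distribution of an irreducible nonnegative matrix is strictly positive. -/
theorem Matrix.stationary_pos_of_accessible {ι : Type*} [Fintype ι] [DecidableEq ι]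
    (A : Matrix ι ι ℝ) (hA : ∀ i j, 0 ≤ A i j) (p : ι → ℝ) (hp : ∀ i, 0 ≤ p i)
    (hsum : ∑ i, p i = 1) (hfix : A.mulVec p = p)
    (hacc : ∀ x y, ∃ m : ℕ, 0 < (A ^ m) x y) (x : ι) : 0 < p x := by
  have hpow : ∀ m : ℕ, (∀ i j, 0 ≤ (A ^ m) i j) ∧ (A ^ m).mulVec p = p := by
    intro m
    induction m with
    | zero =>
      refine ⟨fun i j => ?_, by simp⟩
      rw [pow_zero, Matrix.one_apply]
      split_ifs <;> norm_num
    | succ m ih =>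
      refine ⟨fun i j => ?_, ?_⟩
      · rw [pow_succ, Matrix.mul_apply]
        exact Finset.sum_nonneg fun k _ => mul_nonneg (ih.1 i k) (hA k j)
      · rw [pow_succ, ← Matrix.mulVec_mulVec, hfix, ih.2]
  obtain ⟨y, -, hy⟩ : ∃ y ∈ Finset.univ, 0 < p y :=
    (Finset.sum_pos_iff_of_nonneg fun i _ => hp i).1 (hsum ▸ one_pos)
  obtain ⟨m, hm⟩ := hacc x y
  rw [← (hpow m).2]
  exact Finset.sum_pos' (fun j _ => mul_nonneg ((hpow m).1 x j) (hp j))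
    ⟨y, Finset.mem_univ y, mul_pos hm hy⟩

/-- **Theorem 5 (finite-state form): the stationary distribution of stochastic rounding
is asymptotically invariant to the learning rate.**
Let `Ũ` be a nonnegative `n×n` matrix with zero diagonal, let `α₀ > 0` be the largest
constant such that `T̃_{α₀} := I − α₀·diag(𝟙ᵀŨ) + α₀·Ũ` is nonnegative, and suppose
`T̃_{α₀}` is column-stochastic with stationary distribution `π̃` that is the unique
eigenvector (up to scaling) for the simple eigenvalue `1`.  Let `(T_α)` be a family of
column-stochastic matrices with `|T_α(x,y) − T̃_α(x,y)| ≤ C·α²` entrywise for all small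
`α > 0`, where `T̃_α := I − α·diag(𝟙ᵀŨ) + α·Ũ`.  Then for all sufficiently small `α`,
`T_α` has a stationary distribution `π_α`, and `π_α → π̃` as `α → 0`.  Moreover, if every
state of the chain `T̃_{α₀}` is accessible from every other state, then `π̃(x) > 0` for
every state `x`: the limiting distribution is not concentrated on a strict subset of
states. -/
theorem sr_stationary_distribution_limit
    {n : ℕ} (hn : 1 ≤ n)
    (U : Matrix (Fin n) (Fin n) ℝ)
    (hUnn : ∀ i j, 0 ≤ U i j) (hUdiag : ∀ i, U i i = 0)
    (Ttil : ℝ → Matrix (Fin n) (Fin n) ℝ)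
    (hTtil : ∀ α, Ttil α =
      1 - α • Matrix.diagonal (fun j => ∑ i, U i j) + α • U)
    (α₀ : ℝ) (hα₀pos : 0 < α₀)
    (hα₀nn : ∀ i j, 0 ≤ Ttil α₀ i j)
    (hα₀max : ∀ β : ℝ, (∀ i j, 0 ≤ Ttil β i j) → β ≤ α₀)
    (hα₀col : ∀ j, ∑ i, Ttil α₀ i j = 1)
    (πt : Fin n → ℝ) (hπnn : ∀ i, 0 ≤ πt i) (hπsum : ∑ i, πt i = 1)
    (hstat : (Ttil α₀).mulVec πt = πt)
    -- `1` is a simple eigenvalue of `T̃_{α₀}` with eigenvector `π̃`, unique up to scaling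
    (hsimple : ∀ v : Fin n → ℝ, (Ttil α₀).mulVec v = v → ∃ c : ℝ, v = c • πt)
    (T : ℝ → Matrix (Fin n) (Fin n) ℝ)
    (hTstoch : ∀ α : ℝ, 0 < α → (∀ i j, 0 ≤ T α i j) ∧ ∀ j, ∑ i, T α i j = 1)
    (C : ℝ)
    (happrox : ∀ᶠ α in nhdsWithin (0:ℝ) (Set.Ioi 0),
      ∀ i j, |T α i j - Ttil α i j| ≤ C * α ^ 2) :
    ∃ πa : ℝ → Fin n → ℝ,
      (∀ᶠ α in nhdsWithin (0:ℝ) (Set.Ioi 0),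
        (∀ i, 0 ≤ πa α i) ∧ (∑ i, πa α i = 1) ∧ (T α).mulVec (πa α) = πa α) ∧
      Tendsto πa (nhdsWithin (0:ℝ) (Set.Ioi 0)) (nhds πt) ∧
      ((∀ x y : Fin n, ∃ m : ℕ, 0 < ((Ttil α₀) ^ m) x y) → ∀ x, 0 < πt x) := by
  have : Nonempty (Fin n) := ⟨⟨0, hn⟩⟩
  have hexists : ∀ α : ℝ, ∃ v : Fin n → ℝ, 0 < α →
      (∀ i, 0 ≤ v i) ∧ ∑ i, v i = 1 ∧ (T α).mulVec v = v := fun α => by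
    by_cases hα : 0 < α
    · obtain ⟨v, hv⟩ := Matrix.exists_stationary_of_colStochastic (T α)
        (hTstoch α hα).1 (hTstoch α hα).2
      exact ⟨v, fun _ => hv⟩
    · exact ⟨0, fun h => absurd h hα⟩
  choose πa hπa using hexists
  set Q : Matrix (Fin n) (Fin n) ℝ := U - Matrix.diagonal (fun j => ∑ i, U i j) with hQ
  have hTQ : ∀ α, Ttil α = 1 + α • Q := fun α => by
    rw [hTtil, hQ, smul_sub]
    abel
  refine ⟨πa, ?_, ?_, ?_⟩
  · filter_upwards [self_mem_nhdsWithin] with α hα using hπa α hα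
  · refine Matrix.tendsto_stationary_of_approx Q πt (fun q hq hq0 => ?_) T C ?_ πa hπa
    · obtain ⟨c, rfl⟩ := hsimple q (by
        rw [hTQ, Matrix.add_mulVec, Matrix.one_mulVec, Matrix.smul_mulVec, hq0, smul_zero,
          add_zero])
      have hc : c = 1 := by
        simpa [← Finset.mul_sum, hπsum] using hq
      rw [hc, one_smul]
    · simpa only [hTQ] using happrox
  · exact Matrix.stationary_pos_of_accessible (Ttil α₀) hα₀nn πt hπnn hπsum hstat
end

section
/- (Entrywise approximation of the SR transition matrix, step in the proof of Theorem 5) Under the assumptions of Theorem 5 (each stochastic-gradient coordinate density p_{x,k} satisfies ∫_ν^∞ p_{x,k}(z) dz ≤ C₁/ν² for all ν > 0), the one-step transition probability T_α(x,y) of the stochastic-rounding Markov chain between two states x, y that differ in more than one coordinate satisfies T_α(x,y) = Π_{k : x_k ≠ y_k} T_α(x, x + (y_k − x_k)Δ e_k) ≤ O(α²); that is, simultaneous transitions in multiple coordinates become vanishingly unlikely (of second order in α) as the learning rate α → 0. -/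
open MeasureTheory Filter Asymptotics

/-- A density on `ℝ` with quadratically decaying tails has a finite first absolute moment. -/
theorem integrable_mul_abs_of_tail_le {p : ℝ → ℝ} {C : ℝ} (hmeas : Measurable p)
    (hnn : ∀ z, 0 ≤ p z) (hint : Integrable p) (hdens : ∫ z, p z = 1)
    (hU : ∀ ν : ℝ, 0 < ν → ∫ z in Set.Ioi ν, p z ≤ C / ν ^ 2)
    (hL : ∀ ν : ℝ, 0 < ν → ∫ z in Set.Iio (-ν), p z ≤ C / ν ^ 2) :
    Integrable fun z => p z * |z| := by
  set μ : Measure ℝ := volume.withDensity fun z => ENNReal.ofReal (p z)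
  have hbound : ∀ t ∈ Set.Ioi (0 : ℝ),
      μ {z | t < |z|} ≤ ENNReal.ofReal ((1 + 2 * C) * (1 + t ^ 2)⁻¹) := by
    intro t ht
    have ht : 0 < t := ht
    have hset : {z : ℝ | t < |z|} = Set.Ioi t ∪ Set.Iio (-t) := by
      ext z
      simp [lt_abs, lt_neg]
    have hms : MeasurableSet {z : ℝ | t < |z|} := hset ▸ measurableSet_Ioi.union measurableSet_Iio
    rw [withDensity_apply _ hms, ← ofReal_integral_eq_lintegral_ofReal hint.integrableOn
      (ae_of_all _ hnn)]
    apply ENNReal.ofReal_le_ofReal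
    have hone : ∫ z in {z : ℝ | t < |z|}, p z ≤ 1 :=
      hdens ▸ setIntegral_le_integral hint (ae_of_all _ hnn)
    have htwo : ∫ z in {z : ℝ | t < |z|}, p z ≤ 2 * (C / t ^ 2) := by
      rw [hset, setIntegral_union _ measurableSet_Iio hint.integrableOn hint.integrableOn]
      · linarith [hU t ht, hL t ht]
      · exact Set.disjoint_left.2 fun z (h₁ : t < z) (h₂ : z < -t) => by linarith
    rw [← div_eq_mul_inv, le_div_iff₀ (by positivity)]
    have hmul := mul_le_mul_of_nonneg_right htwo (sq_nonneg t)
    have hcancel : 2 * (C / t ^ 2) * t ^ 2 = 2 * C := by field_simp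
    linarith
  refine ⟨(hmeas.mul measurable_id.abs).aestronglyMeasurable, ?_⟩
  rw [hasFiniteIntegral_iff_ofReal (ae_of_all _ fun z => mul_nonneg (hnn z) (abs_nonneg z))]
  calc ∫⁻ z, ENNReal.ofReal (p z * |z|)
      = ∫⁻ z, ENNReal.ofReal |z| ∂μ := by
        have habs : Measurable fun z : ℝ => ENNReal.ofReal |z| := measurable_id.abs.ennreal_ofReal
        rw [lintegral_withDensity_eq_lintegral_mul _ hmeas.ennreal_ofReal habs]
        exact lintegral_congr fun z => ENNReal.ofReal_mul (hnn z)
    _ = ∫⁻ t in Set.Ioi (0 : ℝ), μ {z | t < |z|} :=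
        lintegral_eq_lintegral_meas_lt μ (ae_of_all _ abs_nonneg) measurable_id.abs.aemeasurable
    _ ≤ ∫⁻ t in Set.Ioi (0 : ℝ), ENNReal.ofReal ((1 + 2 * C) * (1 + t ^ 2)⁻¹) :=
        setLIntegral_mono' measurableSet_Ioi hbound
    _ < ⊤ := (integrable_inv_one_add_sq.const_mul (1 + 2 * C)).integrableOn.lintegral_lt_top

/-- The hat function centred at a nonzero integer is dominated by the absolute value. -/
theorem max_zero_one_sub_abs_sub_intCast_le {j : ℤ} (hj : j ≠ 0) (u : ℝ) :
    max 0 (1 - |u - (j : ℝ)|) ≤ |u| := by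
  have hone : (1 : ℝ) ≤ |(j : ℝ)| := by exact_mod_cast Int.one_le_abs hj
  refine max_le (abs_nonneg u) ?_
  linarith [abs_sub_abs_le_abs_sub (j : ℝ) u, abs_sub_comm (j : ℝ) u]

/-- **Multi-coordinate transitions of the stochastic-rounding chain are `O(α²)`**
(step in the proof of Theorem 5).
The states of the SR-SGD Markov chain are grid points `x ∈ (Δℤ)^d`, identified with
integer vectors `x : Fin d → ℤ`.  Each coordinate `k` of the stochastic gradient has a
density `p k` satisfying the tail bound `∫_{|z|≥ν} p k ≤ C₁/ν²`.  Under stochastic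
rounding of `x - α g` (coordinatewise, independently), the probability that coordinate
`k` moves by `j·Δ` is `P k α j = ∫ p k (z) · max(0, 1 − |−αz/Δ − j|) dz`, and the
one-step transition probability factors as `T_α(x,y) = ∏_k P k α (y_k − x_k)`.
If `x` and `y` differ in more than one coordinate, then `T_α(x,y)` is bounded by the
product of the single-coordinate move probabilities over the changed coordinates, and
`T_α(x,y) = O(α²)` as `α → 0⁺`: simultaneous transitions in multiple coordinates become
vanishingly unlikely, of second order in `α`. -/
theorem sr_multi_coordinate_transitions_second_order
    (d : ℕ) (Δ C₁ : ℝ) (hΔ : 0 < Δ) (hC₁ : 0 < C₁)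
    (p : Fin d → ℝ → ℝ)
    (hpmeas : ∀ k, Measurable (p k)) (hpnn : ∀ k z, 0 ≤ p k z)
    (hpint : ∀ k, Integrable (p k))
    (hpdens : ∀ k, ∫ z, p k z = 1)
    (htailU : ∀ k, ∀ ν : ℝ, 0 < ν → ∫ z in Set.Ioi ν, p k z ≤ C₁ / ν ^ 2)
    (htailL : ∀ k, ∀ ν : ℝ, 0 < ν → ∫ z in Set.Iio (-ν), p k z ≤ C₁ / ν ^ 2)
    -- `P k α j`: probability that coordinate `k` moves by `j` grid steps
    (P : Fin d → ℝ → ℤ → ℝ)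
    (hP : ∀ k (α : ℝ) (j : ℤ), P k α j =
      ∫ z, p k z * max 0 (1 - |(-(α * z)) / Δ - (j : ℝ)|))
    -- the chain rounds each coordinate independently, so transition probabilities factor
    (T : ℝ → (Fin d → ℤ) → (Fin d → ℤ) → ℝ)
    (hT : ∀ (α : ℝ) (a b : Fin d → ℤ), T α a b = ∏ k, P k α (b k - a k))
    (x y : Fin d → ℤ)
    (hxy : 1 < (Finset.univ.filter fun k => x k ≠ y k).card) :
    (∀ α : ℝ, T α x y ≤
        ∏ k ∈ Finset.univ.filter fun k => x k ≠ y k, P k α (y k - x k)) ∧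
    (fun α => T α x y) =O[nhdsWithin (0:ℝ) (Set.Ioi 0)] (fun α => α ^ 2) := by
  have hPnn : ∀ k α j, 0 ≤ P k α j := fun k α j => by
    rw [hP]
    exact integral_nonneg fun z => mul_nonneg (hpnn k z) (le_max_left _ _)
  have hPone : ∀ k α j, P k α j ≤ 1 := fun k α j => by
    rw [hP]
    refine (integral_mono_of_nonneg
      (ae_of_all _ fun z => mul_nonneg (hpnn k z) (le_max_left _ _)) (hpint k)
      (ae_of_all _ fun z => mul_le_of_le_one_right (hpnn k z) (max_le zero_le_one ?_))).trans_eq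
        (hpdens k)
    linarith [abs_nonneg (-(α * z) / Δ - (j : ℝ))]
  have hPlin : ∀ k α j, 0 < α → j ≠ 0 → P k α j ≤ (∫ z, p k z * |z|) / Δ * α := by
    intro k α j hα hj
    have hmoment := integrable_mul_abs_of_tail_le (hpmeas k) (hpnn k) (hpint k) (hpdens k)
      (htailU k) (htailL k)
    rw [hP, div_mul_eq_mul_div, mul_div_assoc, ← integral_mul_const]
    refine integral_mono_of_nonneg
      (ae_of_all _ fun z => mul_nonneg (hpnn k z) (le_max_left _ _)) (hmoment.mul_const _)
      (ae_of_all _ fun z => ?_)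
    refine (mul_le_mul_of_nonneg_left (max_zero_one_sub_abs_sub_intCast_le hj _)
      (hpnn k z)).trans_eq ?_
    rw [abs_div, abs_neg, abs_mul, abs_of_pos hα, abs_of_pos hΔ]
    ring
  have hTle : ∀ α : ℝ, T α x y ≤
      ∏ k ∈ Finset.univ.filter fun k => x k ≠ y k, P k α (y k - x k) := fun α => by
    rw [hT]
    exact Finset.prod_le_prod_of_subset_of_le_one (Finset.filter_subset _ _)
      (fun k _ => hPnn k α _) (fun k _ _ => hPone k α _)
  refine ⟨hTle, IsBigO.of_bound
    (∏ k ∈ Finset.univ.filter fun k => x k ≠ y k, (∫ z, p k z * |z|) / Δ) ?_⟩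
  filter_upwards [Ioo_mem_nhdsGT (zero_lt_one' ℝ)] with α hα
  rw [Real.norm_of_nonneg (hT α x y ▸ Finset.prod_nonneg fun k _ => hPnn k α _),
    Real.norm_of_nonneg (sq_nonneg α)]
  refine (hTle α).trans ((Finset.prod_le_prod (fun k _ => hPnn k α _) fun k hk =>
    hPlin k α _ hα.1 (sub_ne_zero.2 (Finset.mem_filter.1 hk).2.symm)).trans ?_)
  rw [Finset.prod_mul_distrib, Finset.prod_const]
  exact mul_le_mul_of_nonneg_left (pow_le_pow_of_le_one hα.1.le hα.2.le hxy)
    (Finset.prod_nonneg fun k _ => div_nonneg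
      (integral_nonneg fun z => mul_nonneg (hpnn k z) (abs_nonneg z)) hΔ.le)
end
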